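/- Let T be a subsystem of a Lie triple system S over a field F. Then S is a system of quotients of T if and only if S is ideally absorbed into T. -/

import Mathlib

/-- A Lie triple system structure on an `F`-vector space `S`:
a trilinear map `b` satisfying `[x,x,z] = 0`, the cyclic identity and the
Leibniz (derivation) identity. -/
structure LTSStruct (F : Type*) (S : Type*) [Field F] [AddCommGroup S] [Module F S] where
  b : S → S → S → S
  add₁ : ∀ x x' y z, b (x + x') y z = b x y z + b x' y z
  smul₁ : ∀ (c : F) (x y z : S), b (c • x) y z = c • b x y z
  add₂ : ∀ x y y' z, b x (y + y') z = b x y z + b x y' z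
  smul₂ : ∀ (c : F) (x y z : S), b x (c • y) z = c • b x y z
  add₃ : ∀ x y z z', b x y (z + z') = b x y z + b x y z'
  smul₃ : ∀ (c : F) (x y z : S), b x y (c • z) = c • b x y z
  alt : ∀ x z, b x x z = 0
  cyclic : ∀ x y z, b x y z + b y z x + b z x y = 0
  leibniz : ∀ u v x y z,
    b u v (b x y z) = b (b u v x) y z + b x (b u v y) z + b x y (b u v z)

namespace LTSStruct

variable {F : Type*} [Field F] {S : Type*} [AddCommGroup S] [Module F S]

/-- `I` is an ideal of the whole Lie triple system `S`: `[I,S,S] ⊆ I`. -/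
def IsIdeal (L : LTSStruct F S) (I : Submodule F S) : Prop :=
  ∀ x ∈ I, ∀ y z : S, L.b x y z ∈ I

/-- `T` is a subsystem of `S`: `[T,T,T] ⊆ T`. -/
def IsSubsystem (L : LTSStruct F S) (T : Submodule F S) : Prop :=
  ∀ x ∈ T, ∀ y ∈ T, ∀ z ∈ T, L.b x y z ∈ T

/-- `I` is an ideal of the subsystem `T`: `I ⊆ T` and `[I,T,T] ⊆ I`. -/
def IsIdealOf (L : LTSStruct F S) (I T : Submodule F S) : Prop :=
  I ≤ T ∧ ∀ x ∈ I, ∀ y ∈ T, ∀ z ∈ T, L.b x y z ∈ I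

/-- The centralizer of a subset `I` in the whole system `S`:
`C_S(I) = {x ∈ S : [x,I,S] = [S,I,x] = 0}`. -/
def centralizer (L : LTSStruct F S) (I : Set S) : Set S :=
  {x | (∀ i ∈ I, ∀ t : S, L.b x i t = 0) ∧ (∀ t : S, ∀ i ∈ I, L.b t i x = 0)}

/-- The centralizer of a subset `I` in a subsystem `T`:
`C_T(I) = {x ∈ T : [x,I,T] = [T,I,x] = 0}`. -/
def relCentralizer (L : LTSStruct F S) (T : Submodule F S) (I : Set S) : Set S :=
  {x | x ∈ T ∧ (∀ i ∈ I, ∀ t ∈ T, L.b x i t = 0) ∧ (∀ t ∈ T, ∀ i ∈ I, L.b t i x = 0)}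

/-- The center `C(S) = {x ∈ S : [x,S,S] = 0}`. -/
def center (L : LTSStruct F S) : Set S := {x | ∀ y z : S, L.b x y z = 0}

/-- The center of a subsystem `T`: `C(T) = {x ∈ T : [x,T,T] = 0}`. -/
def relCenter (L : LTSStruct F S) (T : Submodule F S) : Set S :=
  {x | x ∈ T ∧ ∀ y ∈ T, ∀ z ∈ T, L.b x y z = 0}

/-- `S` is semiprime: `[S,I,I] ≠ 0` for every nonzero ideal `I`. -/
def IsSemiprime (L : LTSStruct F S) : Prop :=
  ∀ I : Submodule F S, L.IsIdeal I → I ≠ ⊥ → ∃ t : S, ∃ i ∈ I, ∃ j ∈ I, L.b t i j ≠ 0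

/-- `S` is prime: `[S,I,J] ≠ 0` for all nonzero ideals `I`, `J`. -/
def IsPrime (L : LTSStruct F S) : Prop :=
  ∀ I J : Submodule F S, L.IsIdeal I → L.IsIdeal J → I ≠ ⊥ → J ≠ ⊥ →
    ∃ t : S, ∃ i ∈ I, ∃ j ∈ J, L.b t i j ≠ 0

/-- `S` is nondegenerate: `[S,x,x] ≠ 0` for every nonzero `x`. -/
def IsNondegenerate (L : LTSStruct F S) : Prop :=
  ∀ x : S, x ≠ 0 → ∃ t : S, L.b t x x ≠ 0

/-- A subsystem `T` is semiprime: `[T,I,I] ≠ 0` for every nonzero ideal `I` of `T`. -/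
def RelSemiprime (L : LTSStruct F S) (T : Submodule F S) : Prop :=
  ∀ I : Submodule F S, L.IsIdealOf I T → I ≠ ⊥ → ∃ t ∈ T, ∃ i ∈ I, ∃ j ∈ I, L.b t i j ≠ 0

/-- A subsystem `T` is prime: `[T,I,J] ≠ 0` for all nonzero ideals `I`, `J` of `T`. -/
def RelPrime (L : LTSStruct F S) (T : Submodule F S) : Prop :=
  ∀ I J : Submodule F S, L.IsIdealOf I T → L.IsIdealOf J T → I ≠ ⊥ → J ≠ ⊥ →
    ∃ t ∈ T, ∃ i ∈ I, ∃ j ∈ J, L.b t i j ≠ 0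

/-- A subsystem `T` is nondegenerate: `[T,x,x] ≠ 0` for every nonzero `x ∈ T`. -/
def RelNondegenerate (L : LTSStruct F S) (T : Submodule F S) : Prop :=
  ∀ x ∈ T, x ≠ 0 → ∃ t ∈ T, L.b t x x ≠ 0

/-- An ideal `I` of `S` is essential if it hits every nonzero ideal of `S`. -/
def IsEssentialIdeal (L : LTSStruct F S) (I : Submodule F S) : Prop :=
  L.IsIdeal I ∧ ∀ J : Submodule F S, L.IsIdeal J → J ≠ ⊥ → I ⊓ J ≠ ⊥

/-- An ideal `I` of the subsystem `T` is essential in `T` if it hits every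
nonzero ideal of `T`. -/
def IsEssentialIdealOf (L : LTSStruct F S) (I T : Submodule F S) : Prop :=
  L.IsIdealOf I T ∧ ∀ J : Submodule F S, L.IsIdealOf J T → J ≠ ⊥ → I ⊓ J ≠ ⊥

/-- The elements `s`, `R(x₁,y₁)⋯R(xₙ,yₙ)(s)` with all `xᵢ, yᵢ ∈ T`, where
`R(x,y)(z) = [z,x,y]`. -/
inductive InIter (L : LTSStruct F S) (T : Submodule F S) (s : S) : S → Prop
  | base : InIter L T s s
  | step (z x y : S) : InIter L T s z → x ∈ T → y ∈ T → InIter L T s (L.b z x y)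

/-- `_T(s)`: the linear span in `S` of `s` and all `R(x₁,y₁)⋯R(xₙ,yₙ)(s)`,
`xᵢ, yᵢ ∈ T`. -/
def innerIdeal (L : LTSStruct F S) (T : Submodule F S) (s : S) : Submodule F S :=
  Submodule.span F {z | InIter L T s z}

/-- `(T:s) = {x ∈ T : [x,T,_T(s)] + [x,_T(s),T] ⊆ T}`. -/
def quotSet (L : LTSStruct F S) (T : Submodule F S) (s : S) : Set S :=
  {x | x ∈ T ∧ ∀ t ∈ T, ∀ u ∈ L.innerIdeal T s, L.b x t u ∈ T ∧ L.b x u t ∈ T}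

/-- `S` is a system of quotients of `T`. -/
def IsSystemOfQuotients (L : LTSStruct F S) (T : Submodule F S) : Prop :=
  L.IsSubsystem T ∧ ∀ s s' : S, s ≠ 0 →
    ∃ x ∈ T, ∃ y ∈ T, L.b s x y ≠ 0 ∧ (x ∈ L.quotSet T s' ∨ y ∈ L.quotSet T s')

/-- `S` is a weak system of quotients of `T`. -/
def IsWeakSystemOfQuotients (L : LTSStruct F S) (T : Submodule F S) : Prop :=
  L.IsSubsystem T ∧ ∀ s : S, s ≠ 0 → ∃ x ∈ T, ∃ y ∈ T, L.b s x y ≠ 0 ∧ L.b s x y ∈ T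

/-- `S` is ideally absorbed into `T`: for every `0 ≠ s ∈ S` there is an ideal `I`
of `T` with `C_T(I) = 0` and `0 ≠ [s,I,T] + [s,T,I] ⊆ T`. -/
def IsIdeallyAbsorbed (L : LTSStruct F S) (T : Submodule F S) : Prop :=
  L.IsSubsystem T ∧ ∀ s : S, s ≠ 0 → ∃ I : Submodule F S, L.IsIdealOf I T ∧
    L.relCentralizer T (I : Set S) = {0} ∧
    (∃ i ∈ I, ∃ t ∈ T, L.b s i t ≠ 0 ∨ L.b s t i ≠ 0) ∧
    (∀ i ∈ I, ∀ t ∈ T, L.b s i t ∈ T ∧ L.b s t i ∈ T)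

end LTSStruct

namespace LTSStruct

variable {F : Type*} [Field F] {S : Type*} [AddCommGroup S] [Module F S]

theorem b_swap (L : LTSStruct F S) (x y z : S) : L.b y x z = -L.b x y z := by
  have h := L.alt (x + y) z
  rw [L.add₁, L.add₂, L.add₂, L.alt, L.alt, zero_add, add_zero] at h
  exact eq_neg_of_add_eq_zero_right h

theorem b_rotate (L : LTSStruct F S) (x y z : S) : L.b y z x = L.b x z y - L.b x y z := by
  have h := L.cyclic x y z
  rw [L.b_swap x z y] at h
  grind

theorem b_zero_left (L : LTSStruct F S) (y z : S) : L.b 0 y z = 0 := by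
  simpa using L.smul₁ 0 0 y z

theorem b_zero_mid (L : LTSStruct F S) (x z : S) : L.b x 0 z = 0 := by
  simpa using L.smul₂ 0 x 0 z

theorem b_zero_right (L : LTSStruct F S) (x y : S) : L.b x y 0 = 0 := by
  simpa using L.smul₃ 0 x y 0

/-- `U` contains all products, in any order, of `x`, an element of `A` and one of `B`. -/
def AllProductsMem (L : LTSStruct F S) (x : S) (A B U : Submodule F S) : Prop :=
  ∀ a ∈ A, ∀ b ∈ B, L.b x a b ∈ U ∧ L.b x b a ∈ U

namespace AllProductsMem

variable {L : LTSStruct F S} {x : S} {A B U : Submodule F S}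

theorem swap_left (h : L.AllProductsMem x A B U) {a b : S} (ha : a ∈ A) (hb : b ∈ B) :
    L.b a x b ∈ U := by
  rw [L.b_swap]; exact U.neg_mem (h a ha b hb).1

theorem swap_right (h : L.AllProductsMem x A B U) {a b : S} (ha : a ∈ A) (hb : b ∈ B) :
    L.b b x a ∈ U := by
  rw [L.b_swap]; exact U.neg_mem (h a ha b hb).2

theorem last (h : L.AllProductsMem x A B U) {a b : S} (ha : a ∈ A) (hb : b ∈ B) :
    L.b a b x ∈ U := by
  rw [L.b_rotate]; exact U.sub_mem (h a ha b hb).2 (h a ha b hb).1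

theorem last_swap (h : L.AllProductsMem x A B U) {a b : S} (ha : a ∈ A) (hb : b ∈ B) :
    L.b b a x ∈ U := by
  rw [L.b_rotate]; exact U.sub_mem (h a ha b hb).1 (h a ha b hb).2

end AllProductsMem

/-- `U` is stable under the action of `T`. -/
def IsStable (L : LTSStruct F S) (T U : Submodule F S) : Prop :=
  ∀ u ∈ U, ∀ x ∈ T, ∀ y ∈ T, L.b u x y ∈ U

theorem IsStable.allProductsMem {L : LTSStruct F S} {T U : Submodule F S} (h : L.IsStable T U)
    {u : S} (hu : u ∈ U) : L.AllProductsMem u T T U :=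
  fun x hx y hy => ⟨h u hu x hx y hy, h u hu y hy x hx⟩

/-- Absorption of `I` and `T` into a stable subspace passes from `z` to `[z,T,T]`. -/
theorem AllProductsMem.b_mem {L : LTSStruct F S} {T I U : Submodule F S}
    (hI : L.IsIdealOf I T) (hU : L.IsStable T U) {z : S} (hz : L.AllProductsMem z I T U)
    {x y : S} (hx : x ∈ T) (hy : y ∈ T) : L.AllProductsMem (L.b z x y) I T U := by
  have hI' : L.IsStable T I := hI.2
  have h₁ : ∀ y ∈ T, ∀ i ∈ I, ∀ t ∈ T, L.b i t (L.b z x y) ∈ U := by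
    intro y hy i hi t ht
    rw [L.leibniz]
    exact U.add_mem (U.add_mem (hU _ (hz.last hi ht) _ hx _ hy)
      (hz _ (hI' i hi t ht x hx) y hy).1) (hz _ (hI' i hi t ht y hy) x hx).2
  intro i hi t ht
  have h₂ : L.b (L.b z x y) i t ∈ U := by
    have h := L.leibniz z x y i t
    have e : L.b (L.b z x y) i t =
        L.b z x (L.b y i t) - L.b y (L.b z x i) t - L.b y i (L.b z x t) := by
      rw [h]; abel
    rw [e]
    refine U.sub_mem (U.sub_mem (hz _ ((hI'.allProductsMem hi).swap_left hy ht) x hx).2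
      ((hU.allProductsMem (hz i hi x hx).2).swap_left hy ht)) ?_
    rw [L.b_swap i]
    exact U.neg_mem (h₁ t ht i hi y hy)
  refine ⟨h₂, ?_⟩
  have e := L.b_rotate (L.b z x y) i t
  rw [← sub_add_cancel (L.b (L.b z x y) t i) (L.b (L.b z x y) i t), ← e]
  exact U.add_mem (h₁ y hy i hi t ht) h₂

/-- If `T` and the stable subspace `M` are absorbed by `x`, they are absorbed by `[x,T,T]`. -/
theorem AllProductsMem.b_mem_subsystem {L : LTSStruct F S} {T M : Submodule F S}
    (hT : L.IsSubsystem T) (hM : L.IsStable T M) {x : S}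
    (hx : L.AllProductsMem x T M T) {y z : S} (hy : y ∈ T) (hz : z ∈ T) :
    L.AllProductsMem (L.b x y z) T M T := by
  have h₁ : ∀ z ∈ T, ∀ t ∈ T, ∀ m ∈ M, L.b t m (L.b x y z) ∈ T := by
    intro z hz t ht m hm
    rw [L.leibniz]
    exact T.add_mem (T.add_mem (hT _ (hx.last ht hm) _ hy _ hz)
      (hx z hz _ ((hM.allProductsMem hm).swap_left ht hy)).2)
      (hx y hy _ ((hM.allProductsMem hm).swap_left ht hz)).1
  intro t ht m hm
  have h₂ : L.b m (L.b x y z) t ∈ T := by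
    have e : L.b m (L.b x y z) t =
        L.b x y (L.b m z t) - L.b (L.b x y m) z t - L.b m z (L.b x y t) := by
      rw [L.leibniz]; abel
    rw [e]
    refine T.sub_mem (T.sub_mem (hx y hy _ (hM m hm z hz t ht)).1
      (hT _ (hx y hy m hm).1 z hz t ht)) ?_
    rw [L.b_swap z]
    exact T.neg_mem (h₁ t ht z hz m hm)
  have h₃ : L.b (L.b x y z) m t ∈ T := by
    rw [L.b_swap m]; exact T.neg_mem h₂
  refine ⟨?_, h₃⟩
  have e : L.b (L.b x y z) t m = L.b (L.b x y z) m t - L.b t m (L.b x y z) := by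
    rw [L.b_rotate (L.b x y z) t m]; abel
  rw [e]
  exact T.sub_mem h₃ (h₁ z hz t ht m hm)

theorem mem_innerIdeal_self (L : LTSStruct F S) (T : Submodule F S) (s : S) :
    s ∈ L.innerIdeal T s :=
  Submodule.subset_span InIter.base

theorem isStable_innerIdeal (L : LTSStruct F S) (T : Submodule F S) (s : S) :
    L.IsStable T (L.innerIdeal T s) := by
  intro u hu x hx y hy
  induction hu using Submodule.span_induction with
  | mem z hz => exact Submodule.subset_span (InIter.step z x y hz hx hy)
  | zero => rw [L.b_zero_left]; exact Submodule.zero_mem _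
  | add u v _ _ hu hv => rw [L.add₁]; exact Submodule.add_mem _ hu hv
  | smul c u _ hu => rw [L.smul₁]; exact Submodule.smul_mem _ c hu

/-- The set `(T:s)` as a subspace. -/
def quotSubmodule (L : LTSStruct F S) (T : Submodule F S) (s : S) : Submodule F S where
  carrier := L.quotSet T s
  zero_mem' := ⟨T.zero_mem, fun t _ u _ => by simp [L.b_zero_left]⟩
  add_mem' := fun ha hb => ⟨T.add_mem ha.1 hb.1, fun t ht u hu => by
    rw [L.add₁, L.add₁]
    exact ⟨T.add_mem (ha.2 t ht u hu).1 (hb.2 t ht u hu).1,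
      T.add_mem (ha.2 t ht u hu).2 (hb.2 t ht u hu).2⟩⟩
  smul_mem' := fun c _ ha => ⟨T.smul_mem c ha.1, fun t ht u hu => by
    rw [L.smul₁, L.smul₁]
    exact ⟨T.smul_mem c (ha.2 t ht u hu).1, T.smul_mem c (ha.2 t ht u hu).2⟩⟩

theorem isIdealOf_quotSubmodule (L : LTSStruct F S) {T : Submodule F S} (hT : L.IsSubsystem T)
    (s : S) : L.IsIdealOf (L.quotSubmodule T s) T :=
  ⟨fun _ hx => hx.1, fun x hx y hy z hz => ⟨hT x hx.1 y hy z hz,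
    AllProductsMem.b_mem_subsystem hT (L.isStable_innerIdeal T s) hx.2 hy hz⟩⟩

theorem le_quotSubmodule (L : LTSStruct F S) {T I : Submodule F S} (hT : L.IsSubsystem T)
    (hI : L.IsIdealOf I T) {s : S} (hs : L.AllProductsMem s I T T) :
    I ≤ L.quotSubmodule T s := by
  have key : ∀ u ∈ L.innerIdeal T s, L.AllProductsMem u I T T := by
    intro u hu
    induction hu using Submodule.span_induction with
    | mem z hz =>
      induction hz with
      | base => exact hs
      | step z x y _ hx hy ih => exact ih.b_mem hI hT hx hy
    | zero => intro i _ t _; simp [L.b_zero_left]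
    | add u v _ _ hu hv =>
      intro i hi t ht
      rw [L.add₁, L.add₁]
      exact ⟨T.add_mem (hu i hi t ht).1 (hv i hi t ht).1,
        T.add_mem (hu i hi t ht).2 (hv i hi t ht).2⟩
    | smul c u _ hu =>
      intro i hi t ht
      rw [L.smul₁, L.smul₁]
      exact ⟨T.smul_mem c (hu i hi t ht).1, T.smul_mem c (hu i hi t ht).2⟩
  exact fun i hi => ⟨hI.1 hi, fun t ht u hu =>
    ⟨(key u hu).last hi ht, (key u hu).swap_left hi ht⟩⟩

theorem innerIdeal_zero (L : LTSStruct F S) (T : Submodule F S) : L.innerIdeal T 0 = ⊥ := by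
  refine Submodule.span_eq_bot.2 fun z hz => ?_
  induction hz with
  | base => rfl
  | step z x y _ _ _ ih => rw [ih, L.b_zero_left]

theorem quotSet_zero (L : LTSStruct F S) (T : Submodule F S) : L.quotSet T 0 = T := by
  ext x
  simp [quotSet, innerIdeal_zero, b_zero_mid, b_zero_right]

theorem IsSystemOfQuotients.isIdeallyAbsorbed {L : LTSStruct F S} {T : Submodule F S}
    (h : L.IsSystemOfQuotients T) : L.IsIdeallyAbsorbed T := by
  obtain ⟨hT, h⟩ := h
  refine ⟨hT, fun s hs => ⟨L.quotSubmodule T s, L.isIdealOf_quotSubmodule hT s, ?_, ?_, ?_⟩⟩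
  · ext x
    simp only [Set.mem_singleton_iff]
    constructor
    · rintro ⟨_, h₁, h₂⟩
      by_contra hx
      obtain ⟨a, ha, b, hb, hne, hab | hab⟩ := h x s hx
      · exact hne (h₁ a hab b hb)
      · apply hne
        have e := L.b_rotate x a b
        rw [h₁ b hab a ha, h₂ a ha b hab] at e
        simpa using e.symm
    · rintro rfl
      exact ⟨T.zero_mem, fun _ _ _ _ => L.b_zero_left _ _, fun _ _ _ _ => L.b_zero_right _ _⟩
  · obtain ⟨a, ha, b, hb, hne, hab | hab⟩ := h s s hs
    · exact ⟨a, hab, b, hb, Or.inl hne⟩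
    · exact ⟨b, hab, a, ha, Or.inr hne⟩
  · intro i hi t ht
    have hi' : L.AllProductsMem i T (L.innerIdeal T s) T := hi.2
    exact ⟨hi'.swap_right ht (L.mem_innerIdeal_self T s),
      hi'.last_swap ht (L.mem_innerIdeal_self T s)⟩

theorem IsIdeallyAbsorbed.isSystemOfQuotients {L : LTSStruct F S} {T : Submodule F S}
    (h : L.IsIdeallyAbsorbed T) : L.IsSystemOfQuotients T := by
  obtain ⟨hT, h⟩ := h
  refine ⟨hT, fun s s' hs => ?_⟩
  obtain ⟨J, hJ, -, ⟨j, hj, t, ht, hne⟩, hJT⟩ := h s hs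
  obtain ⟨x, hx, y, hy, hxy, hxyT⟩ : ∃ x ∈ T, ∃ y ∈ T, L.b s x y ≠ 0 ∧ L.b s x y ∈ T := by
    rcases hne with hne | hne
    · exact ⟨j, hJ.1 hj, t, ht, hne, (hJT j hj t ht).1⟩
    · exact ⟨t, ht, j, hJ.1 hj, hne, (hJT j hj t ht).2⟩
  by_cases hs' : s' = 0
  · subst hs'
    exact ⟨x, hx, y, hy, hxy, Or.inl (by rwa [quotSet_zero])⟩
  obtain ⟨I, hI, hC, -, hIT⟩ := h s' hs'
  have hIq := L.le_quotSubmodule hT hI hIT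
  by_contra! hcon
  have hsI : L.AllProductsMem s I T ⊥ := by
    refine fun i hi t ht => ⟨?_, ?_⟩ <;> rw [Submodule.mem_bot] <;> by_contra hne
    · exact (hcon i (hI.1 hi) t ht hne).1 (hIq hi)
    · exact (hcon t ht i (hI.1 hi) hne).2 (hIq hi)
  have hbot : L.IsStable T ⊥ := by
    intro u hu x _ y _
    rw [(Submodule.mem_bot F).1 hu, L.b_zero_left]
    exact Submodule.zero_mem _
  have hp := hsI.b_mem hI hbot hx hy
  have hmem : L.b s x y ∈ L.relCentralizer T (I : Set S) :=
    ⟨hxyT, fun i hi t ht => (Submodule.mem_bot F).1 (hp i hi t ht).1,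
      fun t ht i hi => (Submodule.mem_bot F).1 (hp.last_swap hi ht)⟩
  rw [hC] at hmem
  exact hxy hmem

end LTSStruct

/-- `S` is a system of quotients of `T` iff `S` is ideally
absorbed into `T`. -/
theorem isSystemOfQuotients_iff_isIdeallyAbsorbed
    {F S : Type*} [Field F] [AddCommGroup S] [Module F S]
    (L : LTSStruct F S) (T : Submodule F S) (hT : L.IsSubsystem T) :
    L.IsSystemOfQuotients T ↔ L.IsIdeallyAbsorbed T :=
  ⟨LTSStruct.IsSystemOfQuotients.isIdeallyAbsorbed, LTSStruct.IsIdeallyAbsorbed.isSystemOfQuotients⟩
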